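/- arXiv:1501.03957 — 2 statements merged into one kernel-verified Lean document; each statement's English description precedes it below -/
import Mathlib

section
/- Let ω be a radial weight on the unit disc. Then ω belongs to the class D̂ if and only if the moments ω_x = ∫_0^1 s^x ω(s) ds satisfy ω_x ≍ ω̂(1 - 1/x) for all x ≥ 1, with comparison constants independent of x; that is, there exist constants C₁, C₂ > 0 such that C₁ ω̂(1 - 1/x) ≤ ∫_0^1 s^x ω(s) ds ≤ C₂ ω̂(1 - 1/x) for every x ≥ 1. -/
open MeasureTheory Set

noncomputable section

/-- `wh ω r = ω̂(r) = ∫_r^1 ω(s) ds`. -/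
def wh (ω : ℝ → ℝ) (r : ℝ) : ℝ := ∫ s in r..1, ω s

theorem intervalIntegrable_of_subset_unit {ω : ℝ → ℝ} (hint : IntegrableOn ω (Ioo 0 1))
    {a b : ℝ} (ha : 0 ≤ a) (hab : a ≤ b) (hb : b ≤ 1) : IntervalIntegrable ω volume a b := by
  rw [intervalIntegrable_iff_integrableOn_Ioo_of_le hab]
  exact hint.mono_set (Ioo_subset_Ioo ha hb)

theorem intervalIntegrable_rpow_mul {ω : ℝ → ℝ} (hint : IntegrableOn ω (Ioo 0 1))
    {x a b : ℝ} (hx : 0 ≤ x) (ha : 0 ≤ a) (hab : a ≤ b) (hb : b ≤ 1) :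
    IntervalIntegrable (fun s => s ^ x * ω s) volume a b :=
  (intervalIntegrable_of_subset_unit hint ha hab hb).continuousOn_mul
    (Real.continuous_rpow_const hx).continuousOn

theorem wh_nonneg {ω : ℝ → ℝ} (hnn : ∀ r, 0 ≤ ω r) {r : ℝ} (hr : r ≤ 1) : 0 ≤ wh ω r :=
  intervalIntegral.integral_nonneg hr fun s _ => hnn s

theorem wh_anti {ω : ℝ → ℝ} (hnn : ∀ r, 0 ≤ ω r) (hint : IntegrableOn ω (Ioo 0 1))
    {a b : ℝ} (ha : 0 ≤ a) (hab : a ≤ b) (hb : b ≤ 1) : wh ω b ≤ wh ω a := by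
  unfold wh
  rw [← intervalIntegral.integral_add_adjacent_intervals
    (intervalIntegrable_of_subset_unit hint ha hab hb)
    (intervalIntegrable_of_subset_unit hint (ha.trans hab) hb le_rfl)]
  linarith [intervalIntegral.integral_nonneg (μ := volume) hab fun s _ => hnn s]

theorem rpow_mul_wh_le_moment {ω : ℝ → ℝ} (hnn : ∀ r, 0 ≤ ω r)
    (hint : IntegrableOn ω (Ioo 0 1)) {r x : ℝ} (hr : 0 ≤ r) (hr1 : r ≤ 1) (hx : 0 ≤ x) :
    r ^ x * wh ω r ≤ ∫ s in (0:ℝ)..1, s ^ x * ω s := by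
  rw [← intervalIntegral.integral_add_adjacent_intervals
    (intervalIntegrable_rpow_mul hint hx le_rfl hr hr1)
    (intervalIntegrable_rpow_mul hint hx hr hr1 le_rfl)]
  have h0 : 0 ≤ ∫ s in (0:ℝ)..r, s ^ x * ω s :=
    intervalIntegral.integral_nonneg hr fun s hs =>
      mul_nonneg (Real.rpow_nonneg hs.1 x) (hnn s)
  have h1 : r ^ x * wh ω r ≤ ∫ s in r..1, s ^ x * ω s := by
    unfold wh
    rw [← intervalIntegral.integral_const_mul]
    refine intervalIntegral.integral_mono_on hr1
      ((intervalIntegrable_of_subset_unit hint hr hr1 le_rfl).const_mul _)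
      (intervalIntegrable_rpow_mul hint hx hr hr1 le_rfl) fun s hs => ?_
    exact mul_le_mul_of_nonneg_right (Real.rpow_le_rpow hr hs.1 hx) (hnn s)
  linarith

theorem integral_rpow_mul_le {ω : ℝ → ℝ} (hnn : ∀ r, 0 ≤ ω r)
    (hint : IntegrableOn ω (Ioo 0 1)) {a b x : ℝ} (ha : 0 ≤ a) (hab : a ≤ b) (hb : b ≤ 1)
    (hx : 0 ≤ x) : ∫ s in a..b, s ^ x * ω s ≤ b ^ x * wh ω a := by
  have h1 : ∫ s in a..b, s ^ x * ω s ≤ b ^ x * ∫ s in a..b, ω s := by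
    rw [← intervalIntegral.integral_const_mul]
    refine intervalIntegral.integral_mono_on hab (intervalIntegrable_rpow_mul hint hx ha hab hb)
      ((intervalIntegrable_of_subset_unit hint ha hab hb).const_mul _) fun s hs => ?_
    exact mul_le_mul_of_nonneg_right (Real.rpow_le_rpow (ha.trans hs.1) hs.2 hx) (hnn s)
  refine h1.trans (mul_le_mul_of_nonneg_left ?_ (Real.rpow_nonneg (ha.trans hab) x))
  unfold wh
  rw [← intervalIntegral.integral_add_adjacent_intervals
    (intervalIntegrable_of_subset_unit hint ha hab hb)
    (intervalIntegrable_of_subset_unit hint (ha.trans hab) hb le_rfl)]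
  linarith [intervalIntegral.integral_nonneg (μ := volume) hb fun s _ => hnn s]

theorem moment_anti {ω : ℝ → ℝ} (hnn : ∀ r, 0 ≤ ω r) (hint : IntegrableOn ω (Ioo 0 1))
    {x y : ℝ} (hx : 0 < x) (hxy : x ≤ y) :
    ∫ s in (0:ℝ)..1, s ^ y * ω s ≤ ∫ s in (0:ℝ)..1, s ^ x * ω s := by
  refine intervalIntegral.integral_mono_on zero_le_one
    (intervalIntegrable_rpow_mul hint (hx.le.trans hxy) le_rfl zero_le_one le_rfl)
    (intervalIntegrable_rpow_mul hint hx.le le_rfl zero_le_one le_rfl) fun s hs => ?_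
  exact mul_le_mul_of_nonneg_right
    (Real.rpow_le_rpow_of_exponent_ge_of_imp hs.1 hs.2 hxy fun _ h => absurd h (hx.trans_le hxy).ne') (hnn s)

theorem wh_zero_eq_zero_of_moment_eq_zero {ω : ℝ → ℝ} (hnn : ∀ r, 0 ≤ ω r)
    (hint : IntegrableOn ω (Ioo 0 1)) {x : ℝ} (hx : 0 ≤ x)
    (h : ∫ s in (0:ℝ)..1, s ^ x * ω s = 0) : wh ω 0 = 0 := by
  have hi := intervalIntegrable_rpow_mul hint hx le_rfl zero_le_one le_rfl
  rw [intervalIntegrable_iff_integrableOn_Ioc_of_le zero_le_one] at hi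
  rw [intervalIntegral.integral_of_le zero_le_one, setIntegral_eq_zero_iff_of_nonneg_ae ?_ hi] at h
  · unfold wh
    rw [intervalIntegral.integral_of_le zero_le_one]
    refine integral_eq_zero_of_ae ?_
    filter_upwards [h, ae_restrict_mem measurableSet_Ioc] with s hs hs0
    exact (mul_eq_zero.1 hs).resolve_left (Real.rpow_pos_of_pos hs0.1 x).ne'
  · filter_upwards [ae_restrict_mem measurableSet_Ioc] with s hs
    exact mul_nonneg (Real.rpow_nonneg hs.1.le x) (hnn s)

theorem one_fourth_le_one_sub_inv_rpow {x : ℝ} (hx : 2 ≤ x) : 1 / 4 ≤ (1 - 1 / x) ^ x := by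
  have hx0 : 0 < x := by linarith
  have h1 : 1 / x ≤ 1 := by rw [div_le_one hx0]; linarith
  have hb := one_add_mul_self_le_rpow_one_add (s := -(1 / x)) (p := x / 2)
    (by linarith) (by linarith)
  have he : 1 + x / 2 * -(1 / x) = 1 / 2 := by field_simp; norm_num
  rw [he, ← sub_eq_add_neg] at hb
  have hs : (1 - 1 / x) ^ x = ((1 - 1 / x) ^ (x / 2)) ^ 2 := by
    rw [← Real.rpow_natCast, ← Real.rpow_mul (by linarith)]
    congr 1
    push_cast
    ring
  rw [hs]
  nlinarith

theorem pow_mul_exp_neg_two_pow_le {C : ℝ} (hC : 1 ≤ C) :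
    ∃ B : ℝ, 0 ≤ B ∧ ∀ k : ℕ, Real.exp (-2 ^ k) * C ^ (k + 1) ≤ B * (1 / 2) ^ k := by
  obtain ⟨m, hm⟩ := pow_unbounded_of_one_lt (2 * C) (one_lt_two (α := ℝ))
  refine ⟨C * m.factorial, by positivity, fun k => ?_⟩
  have h := Real.pow_div_factorial_le_exp ((2:ℝ) ^ k) (by positivity) m
  have hf : (0:ℝ) < m.factorial := by positivity
  rw [div_le_iff₀ hf] at h
  have h2 : (2 * C) ^ k ≤ ((2:ℝ) ^ k) ^ m := by
    rw [← pow_mul, mul_comm k m, pow_mul]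
    exact pow_le_pow_left₀ (by positivity) hm.le k
  rw [Real.exp_neg, inv_mul_le_iff₀ (Real.exp_pos _)]
  have h3 : C ^ (k + 1) = C * (1 / 2) ^ k * (2 * C) ^ k := by
    rw [mul_assoc, ← mul_pow, pow_succ]
    ring
  rw [h3]
  calc C * (1 / 2) ^ k * (2 * C) ^ k
      ≤ C * (1 / 2) ^ k * (Real.exp (2 ^ k) * m.factorial) := by gcongr; exact h2.trans h
    _ = _ := by ring

theorem exists_moment_le_of_doubling {ω : ℝ → ℝ} (hnn : ∀ r, 0 ≤ ω r)
    (hint : IntegrableOn ω (Ioo 0 1)) {C : ℝ} (hC : 1 ≤ C)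
    (hd : ∀ r : ℝ, 0 ≤ r → r < 1 → wh ω r ≤ C * wh ω ((1 + r) / 2)) :
    ∃ C₂ > (0:ℝ), ∀ x : ℝ, 1 ≤ x →
      (∫ s in (0:ℝ)..1, s ^ x * ω s) ≤ C₂ * wh ω (1 - 1 / x) := by
  obtain ⟨B, hB, hBk⟩ := pow_mul_exp_neg_two_pow_le hC
  refine ⟨1 + 2 * B, by positivity, fun x hx => ?_⟩
  have hx0 : 0 < x := by linarith
  set r : ℕ → ℝ := fun k => max 0 (1 - 2 ^ k / x) with hr
  have hr0 (k) : 0 ≤ r k := le_max_left _ _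
  have hr1 (k) : r k < 1 := by
    have : 0 < (2:ℝ) ^ k / x := by positivity
    exact max_lt one_pos (by linarith)
  have hstep (k) : r (k + 1) ≤ r k := by
    have : (2:ℝ) ^ k / x ≤ 2 ^ (k + 1) / x := by gcongr <;> norm_num
    exact max_le_max le_rfl (by linarith)
  have hhalf (k) : r k ≤ (1 + r (k + 1)) / 2 := by
    refine max_le (by linarith [hr0 (k + 1)]) ?_
    have h1 : 1 - 2 ^ (k + 1) / x ≤ r (k + 1) := le_max_right _ _
    have h2 : (2:ℝ) ^ (k + 1) / x = 2 * (2 ^ k / x) := by ring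
    linarith
  have hstart : r 0 = 1 - 1 / x := by
    have : 1 / x ≤ 1 := by rw [div_le_one hx0]; exact hx
    simp only [hr, pow_zero]
    exact max_eq_right (by linarith)
  have hW0 : 0 ≤ wh ω (r 0) := wh_nonneg hnn (hr1 0).le
  have hW (k) : wh ω (r k) ≤ C ^ k * wh ω (r 0) := by
    induction k with
    | zero => simp
    | succ k ih =>
      calc wh ω (r (k + 1)) ≤ C * wh ω ((1 + r (k + 1)) / 2) := hd _ (hr0 _) (hr1 _)
        _ ≤ C * wh ω (r k) := by
          gcongr
          exact wh_anti hnn hint (hr0 k) (hhalf k) (by linarith [hr1 (k + 1)])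
        _ ≤ C * (C ^ k * wh ω (r 0)) := by gcongr
        _ = _ := by ring
  have hpow (k) : r k ^ x ≤ Real.exp (-2 ^ k) := by
    have h1 : r k ≤ Real.exp (-(2 ^ k / x)) :=
      max_le (Real.exp_pos _).le (Real.one_sub_le_exp_neg _)
    calc r k ^ x ≤ Real.exp (-(2 ^ k / x)) ^ x := Real.rpow_le_rpow (hr0 k) h1 hx0.le
      _ = Real.exp (-2 ^ k) := by
        rw [← Real.exp_mul]
        congr 1
        field_simp
  have key (n) : ∫ s in (r n)..1, s ^ x * ω s ≤
      (1 + B * (2 - 2 * (1 / 2) ^ n)) * wh ω (r 0) := by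
    induction n with
    | zero =>
      have := integral_rpow_mul_le hnn hint (hr0 0) (hr1 0).le le_rfl hx0.le
      simpa using this
    | succ n ih =>
      rw [← intervalIntegral.integral_add_adjacent_intervals
        (intervalIntegrable_rpow_mul hint hx0.le (hr0 (n + 1)) (hstep n) (hr1 n).le)
        (intervalIntegrable_rpow_mul hint hx0.le (hr0 n) (hr1 n).le le_rfl)]
      have h1 : ∫ s in (r (n + 1))..(r n), s ^ x * ω s ≤ B * (1 / 2) ^ n * wh ω (r 0) :=
        calc _ ≤ r n ^ x * wh ω (r (n + 1)) :=
              integral_rpow_mul_le hnn hint (hr0 _) (hstep n) (hr1 n).le hx0.le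
          _ ≤ Real.exp (-2 ^ n) * (C ^ (n + 1) * wh ω (r 0)) :=
              mul_le_mul (hpow n) (hW _) (wh_nonneg hnn (hr1 _).le) (Real.exp_pos _).le
          _ = Real.exp (-2 ^ n) * C ^ (n + 1) * wh ω (r 0) := by ring
          _ ≤ _ := mul_le_mul_of_nonneg_right (hBk n) hW0
      calc _ ≤ B * (1 / 2) ^ n * wh ω (r 0) +
            (1 + B * (2 - 2 * (1 / 2) ^ n)) * wh ω (r 0) := add_le_add h1 ih
        _ = _ := by ring
  obtain ⟨n, hn⟩ := pow_unbounded_of_one_lt x (one_lt_two (α := ℝ))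
  have hrn : r n = 0 := by
    have : 1 ≤ 2 ^ n / x := by rw [le_div_iff₀ hx0]; linarith
    exact max_eq_left (by linarith)
  have hfin := key n
  rw [hrn] at hfin
  rw [← hstart]
  refine hfin.trans (mul_le_mul_of_nonneg_right ?_ hW0)
  have : 0 ≤ B * (1 / 2 : ℝ) ^ n := by positivity
  linarith

theorem exists_le_moment_of_doubling {ω : ℝ → ℝ} (hnn : ∀ r, 0 ≤ ω r)
    (hint : IntegrableOn ω (Ioo 0 1)) {C : ℝ} (hC : 1 ≤ C)
    (hd : ∀ r : ℝ, 0 ≤ r → r < 1 → wh ω r ≤ C * wh ω ((1 + r) / 2)) :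
    ∃ C₁ > (0:ℝ), ∀ x : ℝ, 1 ≤ x →
      C₁ * wh ω (1 - 1 / x) ≤ ∫ s in (0:ℝ)..1, s ^ x * ω s := by
  have hC0 : 0 < C := by linarith
  have large {x : ℝ} (hx : 2 ≤ x) :
      1 / 4 * wh ω (1 - 1 / x) ≤ ∫ s in (0:ℝ)..1, s ^ x * ω s := by
    have hx0 : 0 < x := by linarith
    have h0 : 0 < 1 / x := by positivity
    have h1 : 1 / x ≤ 1 := by rw [div_le_one hx0]; linarith
    exact (mul_le_mul_of_nonneg_right (one_fourth_le_one_sub_inv_rpow hx)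
      (wh_nonneg hnn (by linarith))).trans
      (rpow_mul_wh_le_moment hnn hint (by linarith) (by linarith) hx0.le)
  refine ⟨1 / (4 * C), by positivity, fun x hx => ?_⟩
  have hx0 : 0 < x := by linarith
  have h0 : 0 < 1 / x := by positivity
  have h1 : 1 / x ≤ 1 := by rw [div_le_one hx0]; exact hx
  have hw : 0 ≤ wh ω (1 - 1 / x) := wh_nonneg hnn (by linarith)
  rcases le_total 2 x with h2 | h2
  · refine le_trans (mul_le_mul_of_nonneg_right ?_ hw) (large h2)
    exact one_div_le_one_div_of_le (by norm_num) (by linarith)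
  · have ha : wh ω (1 - 1 / x) ≤ wh ω 0 := wh_anti hnn hint le_rfl (by linarith) (by linarith)
    have hb := hd 0 le_rfl one_pos
    have hc := large (x := 2) le_rfl
    have hm := moment_anti hnn hint hx0 h2
    have e1 : ((1 + 0) / 2 : ℝ) = 1 / 2 := by norm_num
    have e2 : (1 - 1 / 2 : ℝ) = 1 / 2 := by norm_num
    rw [e1] at hb
    rw [e2] at hc
    calc 1 / (4 * C) * wh ω (1 - 1 / x) ≤ 1 / (4 * C) * (C * wh ω (1 / 2)) := by
          gcongr
          exact ha.trans hb
      _ = 1 / 4 * wh ω (1 / 2) := by field_simp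
      _ ≤ _ := hc.trans hm

theorem exists_doubling_of_moment_le {ω : ℝ → ℝ} (hnn : ∀ r, 0 ≤ ω r)
    (hint : IntegrableOn ω (Ioo 0 1)) {C₂ : ℝ} (hC : 0 < C₂)
    (hm : ∀ x : ℝ, 1 ≤ x → (∫ s in (0:ℝ)..1, s ^ x * ω s) ≤ C₂ * wh ω (1 - 1 / x)) :
    ∃ C : ℝ, 1 ≤ C ∧ ∀ r : ℝ, 0 ≤ r → r < 1 → wh ω r ≤ C * wh ω ((1 + r) / 2) := by
  have hq : 0 ≤ wh ω (3 / 4) := wh_nonneg hnn (by norm_num)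
  have hz : wh ω 0 ≤ wh ω 0 / wh ω (3 / 4) * wh ω (3 / 4) := by
    rcases hq.eq_or_lt with h | h
    · have h4 := hm 4 (by norm_num)
      have e : (1 - 1 / 4 : ℝ) = 3 / 4 := by norm_num
      rw [e, ← h, mul_zero] at h4
      have h40 : 0 ≤ ∫ s in (0:ℝ)..1, s ^ (4:ℝ) * ω s :=
        intervalIntegral.integral_nonneg zero_le_one fun s hs =>
          mul_nonneg (Real.rpow_nonneg hs.1 _) (hnn s)
      rw [wh_zero_eq_zero_of_moment_eq_zero hnn hint (by norm_num) (le_antisymm h4 h40)]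
      simp
    · rw [div_mul_cancel₀ _ h.ne']
  have hQ : 0 ≤ wh ω 0 / wh ω (3 / 4) := div_nonneg (wh_nonneg hnn zero_le_one) hq
  refine ⟨1 + 16 * C₂ + wh ω 0 / wh ω (3 / 4), by linarith, fun r hr hr1 => ?_⟩
  have hw : 0 ≤ wh ω ((1 + r) / 2) := wh_nonneg hnn (by linarith)
  rcases le_total r (1 / 2) with h | h
  · calc wh ω r ≤ wh ω 0 := wh_anti hnn hint le_rfl hr hr1.le
      _ ≤ wh ω 0 / wh ω (3 / 4) * wh ω (3 / 4) := hz
      _ ≤ wh ω 0 / wh ω (3 / 4) * wh ω ((1 + r) / 2) := by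
        gcongr
        exact wh_anti hnn hint (by linarith) (by linarith) (by norm_num)
      _ ≤ _ := by gcongr; linarith
  · have hr' : 0 < 1 - r := by linarith
    have hy : 2 ≤ 1 / (1 - r) := by rw [le_div_iff₀ hr']; linarith
    have hp := one_fourth_le_one_sub_inv_rpow hy
    rw [one_div_one_div, sub_sub_cancel] at hp
    have hp2 : 1 / 16 ≤ r ^ (1 / (1 - r) * 2) := by
      rw [Real.rpow_mul hr, Real.rpow_two]
      nlinarith
    have hlow := rpow_mul_wh_le_moment hnn hint hr hr1.le (x := 1 / (1 - r) * 2) (by linarith)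
    have hup := hm (1 / (1 - r) * 2) (by linarith)
    have e : 1 - 1 / (1 / (1 - r) * 2) = (1 + r) / 2 := by field_simp; ring
    rw [e] at hup
    have hwr : 0 ≤ wh ω r := wh_nonneg hnn hr1.le
    have h1 := mul_le_mul_of_nonneg_right hp2 hwr
    calc wh ω r ≤ 16 * C₂ * wh ω ((1 + r) / 2) := by linarith
      _ ≤ _ := by gcongr; linarith

/-- A radial weight `ω` belongs to the class `D̂` iff its moments satisfy
`ω_x = ∫_0^1 s^x ω(s) ds ≍ ω̂(1 - 1/x)` for `x ≥ 1`. -/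
theorem stmt1 (ω : ℝ → ℝ) (hnn : ∀ r, 0 ≤ ω r)
    (hint : IntegrableOn ω (Set.Ioo 0 1)) :
    (∃ C : ℝ, 1 ≤ C ∧ ∀ r : ℝ, 0 ≤ r → r < 1 → wh ω r ≤ C * wh ω ((1 + r) / 2)) ↔
      (∃ C₁ > (0:ℝ), ∃ C₂ > (0:ℝ), ∀ x : ℝ, 1 ≤ x →
        C₁ * wh ω (1 - 1 / x) ≤ (∫ s in (0:ℝ)..1, s ^ x * ω s) ∧
        (∫ s in (0:ℝ)..1, s ^ x * ω s) ≤ C₂ * wh ω (1 - 1 / x)) := by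
  constructor
  · rintro ⟨C, hC, hd⟩
    obtain ⟨C₁, hC₁, h₁⟩ := exists_le_moment_of_doubling hnn hint hC hd
    obtain ⟨C₂, hC₂, h₂⟩ := exists_moment_le_of_doubling hnn hint hC hd
    exact ⟨C₁, hC₁, C₂, hC₂, fun x hx => ⟨h₁ x hx, h₂ x hx⟩⟩
  · rintro ⟨_, _, C₂, hC₂, h⟩
    exact exists_doubling_of_moment_le hnn hint hC₂ fun x hx => (h x hx).2
end
end

section
/- Let ω ∈ D̂ with ∫_0^1 ω(r) dr = 1, let α > 0, and let r_n ∈ [0,1) satisfy ω̂(r_n) = 2^{-nα}, with M_n = ⌊1/(1-r_n)⌋. Then for each γ > 0 there exists a constant C = C(α, γ, ω) > 0 such that Σ_{n=0}^∞ 2^{nγ} r^{M_n} ≤ C ω̂(r)^{-γ/α} for all 0 ≤ r < 1. -/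
open MeasureTheory Set

open scoped ENNReal

noncomputable section

/-- `M_n = ⌊1/(1-r_n)⌋`. -/
def Mfl (r : ℕ → ℝ) (n : ℕ) : ℕ := Nat.floor (1 / (1 - r n))

theorem wh_le_wh {ω : ℝ → ℝ} (hnn : ∀ x, 0 ≤ ω x) (hint : IntegrableOn ω (Set.Ioo 0 1))
    {x y : ℝ} (hx : 0 ≤ x) (hxy : x ≤ y) (hy : y ≤ 1) : wh ω y ≤ wh ω x := by
  have hii : IntervalIntegrable ω volume x 1 := by
    rw [intervalIntegrable_iff_integrableOn_Ioo_of_le (hxy.trans hy)]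
    exact hint.mono_set (Set.Ioo_subset_Ioo_left hx)
  exact intervalIntegral.integral_mono_interval hxy hy le_rfl
    (Filter.Eventually.of_forall hnn) hii

theorem wh_le_pow_mul_wh {ω : ℝ → ℝ} (hnn : ∀ x, 0 ≤ ω x)
    (hint : IntegrableOn ω (Set.Ioo 0 1)) {C : ℝ} (hC : 1 ≤ C)
    (hdbl : ∀ x : ℝ, 0 ≤ x → x < 1 → wh ω x ≤ C * wh ω ((1 + x) / 2)) {y : ℝ} (hy : y < 1)
    (k : ℕ) {x : ℝ} (hx : 0 ≤ x) (hxy : x ≤ y) (hk : 1 - x ≤ 2 ^ k * (1 - y)) :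
    wh ω x ≤ C ^ k * wh ω y := by
  have hy0 : 0 ≤ wh ω y := intervalIntegral.integral_nonneg hy.le fun s _ => hnn s
  induction k generalizing x with
  | zero =>
    obtain rfl : x = y := le_antisymm hxy (by linarith)
    simp
  | succ k ih =>
    have h1 := hdbl x hx (hxy.trans_lt hy)
    rw [pow_succ', mul_assoc]
    refine h1.trans (mul_le_mul_of_nonneg_left ?_ (by linarith))
    rcases le_total ((1 + x) / 2) y with h | h
    · exact ih (by linarith) h (by rw [pow_succ] at hk; linarith)
    · refine (wh_le_wh hnn hint (hx.trans hxy) h (by linarith)).trans ?_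
      exact le_mul_of_one_le_left hy0 (one_le_pow₀ hC)

theorem wh_pos {ω : ℝ → ℝ} (hnn : ∀ x, 0 ≤ ω x)
    (hint : IntegrableOn ω (Set.Ioo 0 1)) {C : ℝ} (hC : 1 ≤ C)
    (hdbl : ∀ x : ℝ, 0 ≤ x → x < 1 → wh ω x ≤ C * wh ω ((1 + x) / 2))
    (hone : 0 < wh ω 0) {y : ℝ} (hy0 : 0 ≤ y) (hy : y < 1) : 0 < wh ω y := by
  obtain ⟨k, hk⟩ := pow_unbounded_of_one_lt (1 / (1 - y)) (one_lt_two (α := ℝ))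
  rw [div_lt_iff₀ (by linarith)] at hk
  have h := wh_le_pow_mul_wh hnn hint hC hdbl hy k le_rfl hy0 (by linarith)
  exact pos_of_mul_pos_right (hone.trans_le h) (by positivity)

theorem wh_le_div_pow_mul_wh {ω : ℝ → ℝ} (hnn : ∀ x, 0 ≤ ω x)
    (hint : IntegrableOn ω (Set.Ioo 0 1)) {b : ℕ}
    (hdbl : ∀ x : ℝ, 0 ≤ x → x < 1 → wh ω x ≤ 2 ^ b * wh ω ((1 + x) / 2))
    {x y : ℝ} (hx : 0 ≤ x) (hxy : x ≤ y) (hy : y < 1) :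
    wh ω x ≤ 2 ^ b * ((1 - x) / (1 - y)) ^ b * wh ω y := by
  have hy0 : 0 ≤ wh ω y := intervalIntegral.integral_nonneg hy.le fun s _ => hnn s
  have hy1 : 0 < 1 - y := by linarith
  obtain ⟨n, hn, hn'⟩ := exists_nat_pow_near
    (show (1 : ℝ) ≤ (1 - x) / (1 - y) by rw [le_div_iff₀ hy1]; linarith) (one_lt_two (α := ℝ))
  rw [div_lt_iff₀ hy1] at hn'
  refine (wh_le_pow_mul_wh hnn hint (one_le_pow₀ one_le_two) hdbl hy (n + 1) hx hxy hn'.le).trans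
    (mul_le_mul_of_nonneg_right ?_ hy0)
  rw [← pow_mul, mul_comm b, pow_mul, pow_succ', mul_pow]
  gcongr

theorem pow_floor_le {x y : ℝ} (hx : 0 ≤ x) (hx1 : x < 1) (hy0 : 0 ≤ y) (hy : y < 1) (N : ℕ) :
    x ^ ⌊1 / (1 - y)⌋₊ ≤ N.factorial * 2 ^ N * ((1 - y) / (1 - x)) ^ N := by
  have hx' : 0 < 1 - x := by linarith
  have hy' : 0 < 1 - y := by linarith
  have h1 : 1 ≤ 1 / (1 - y) := by rw [le_div_iff₀ hy']; linarith
  have hfl : 1 / (1 - y) / 2 ≤ (⌊1 / (1 - y)⌋₊ : ℝ) := by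
    have ha := Nat.lt_floor_add_one (1 / (1 - y))
    have hb : (1 : ℝ) ≤ (⌊1 / (1 - y)⌋₊ : ℝ) := by exact_mod_cast Nat.one_le_floor_iff _ |>.2 h1
    linarith
  set T := (1 - x) / (1 - y) / 2 with hT
  have hT0 : 0 < T := by positivity
  have h2 : x ^ ⌊1 / (1 - y)⌋₊ ≤ Real.exp (-T) := by
    calc x ^ ⌊1 / (1 - y)⌋₊ ≤ Real.exp (x - 1) ^ ⌊1 / (1 - y)⌋₊ := by
          gcongr
          linarith [Real.add_one_le_exp (x - 1)]
      _ = Real.exp (⌊1 / (1 - y)⌋₊ * (x - 1)) := (Real.exp_nat_mul _ _).symm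
      _ ≤ Real.exp (-T) := by
          apply Real.exp_le_exp.2
          have := mul_le_mul_of_nonneg_right hfl hx'.le
          have e : 1 / (1 - y) / 2 * (1 - x) = T := by rw [hT]; field_simp
          linarith
  have h3 := Real.pow_div_factorial_le_exp T hT0.le N
  refine h2.trans ?_
  rw [Real.exp_neg]
  calc (Real.exp T)⁻¹ ≤ (T ^ N / N.factorial)⁻¹ := inv_anti₀ (by positivity) h3
    _ = N.factorial * (T⁻¹) ^ N := by rw [inv_div, inv_pow]; rfl
    _ = _ := by
      rw [mul_assoc, ← mul_pow]
      congr 2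
      rw [hT]
      field_simp

theorem summable_pow_natAbs {s : ℝ} (h0 : 0 ≤ s) (h1 : s < 1) :
    Summable fun k : ℤ => s ^ k.natAbs := by
  apply Summable.of_nat_of_neg <;> simpa using summable_geometric_of_lt_one h0 h1

theorem tsum_ofReal_rpow_abs_sub_le {γ : ℝ} (hγ : 0 < γ) {u : ℝ} (hu : 0 ≤ u) :
    ∑' n : ℕ, ENNReal.ofReal ((2 : ℝ) ^ (-γ * |n - u|)) ≤
      ENNReal.ofReal (2 ^ γ * ∑' k : ℤ, ((2 : ℝ) ^ (-γ)) ^ k.natAbs) := by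
  set s : ℝ := (2 : ℝ) ^ (-γ) with hs
  have hs0 : 0 ≤ s := by positivity
  have hs1 : s < 1 := Real.rpow_lt_one_of_one_lt_of_neg one_lt_two (by linarith)
  have hsum := summable_pow_natAbs hs0 hs1
  rw [← tsum_mul_left, ENNReal.ofReal_tsum_of_nonneg (fun k => by positivity) (hsum.mul_left _)]
  have hinj : Function.Injective fun n : ℕ => (n : ℤ) - (⌊u⌋₊ : ℤ) := fun a b h => by
    simpa using h
  refine le_trans ?_ (ENNReal.tsum_comp_le_tsum_of_injective hinj _)
  refine ENNReal.tsum_le_tsum fun n => ENNReal.ofReal_le_ofReal ?_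
  rw [hs, ← Real.rpow_natCast, ← Real.rpow_mul zero_le_two, ← Real.rpow_add two_pos]
  apply Real.rpow_le_rpow_of_exponent_le one_le_two
  rw [Nat.cast_natAbs]
  push_cast
  have h1 := Nat.floor_le hu
  have h2 := Nat.lt_floor_add_one u
  have h3 : |(n : ℝ) - ⌊u⌋₊| ≤ |n - u| + 1 := by
    refine (abs_sub_le (n : ℝ) u ⌊u⌋₊).trans ?_
    gcongr
    rw [abs_le]
    constructor <;> linarith
  nlinarith

/-- For `ω ∈ D̂` with `ω̂(0)=1`, `α > 0` and `γ > 0`: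
`Σ_{n=0}^∞ 2^{nγ} r^{M_n} ≤ C ω̂(r)^{-γ/α}` for all `0 ≤ r < 1`. -/
theorem stmt9 (α : ℝ) (hα : 0 < α)
    (ω : ℝ → ℝ) (hnn : ∀ x, 0 ≤ ω x) (hint : IntegrableOn ω (Set.Ioo 0 1))
    (hdbl : ∃ C : ℝ, 1 ≤ C ∧ ∀ x : ℝ, 0 ≤ x → x < 1 → wh ω x ≤ C * wh ω ((1 + x) / 2))
    (hone : wh ω 0 = 1)
    (r : ℕ → ℝ) (hr : ∀ n, 0 ≤ r n ∧ r n < 1) (hr0 : r 0 = 0)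
    (hrn : ∀ n : ℕ, wh ω (r n) = 2 ^ (-(n : ℝ) * α))
    (γ : ℝ) (hγ : 0 < γ) :
    ∃ C > (0:ℝ), ∀ x : ℝ, 0 ≤ x → x < 1 →
      (∑' n : ℕ, ENNReal.ofReal (2 ^ ((n : ℝ) * γ) * x ^ Mfl r n)) ≤
        ENNReal.ofReal (C * wh ω x ^ (-(γ / α))) := by
  obtain ⟨C, hC, hdbl⟩ := hdbl
  obtain ⟨b, hb⟩ := pow_unbounded_of_one_lt C (one_lt_two (α := ℝ))
  obtain ⟨q, hq⟩ := exists_nat_ge (2 * γ / α)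
  rw [div_le_iff₀ hα] at hq
  have hpos : ∀ {y : ℝ}, 0 ≤ y → y < 1 → 0 < wh ω y := fun h0 h1 =>
    wh_pos hnn hint hC hdbl (by rw [hone]; exact one_pos) h0 h1
  have hdbl' : ∀ x : ℝ, 0 ≤ x → x < 1 → wh ω x ≤ 2 ^ b * wh ω ((1 + x) / 2) :=
    fun x h0 h1 => (hdbl x h0 h1).trans
      (mul_le_mul_of_nonneg_right hb.le (hpos (by linarith) (by linarith)).le)
  set K : ℝ := (b * q).factorial * 2 ^ (b * q) * (2 ^ b) ^ q with hK
  have hK1 : 1 ≤ K := by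
    have h1 : (1 : ℝ) ≤ (b * q).factorial := by
      exact_mod_cast Nat.succ_le_of_lt (Nat.factorial_pos _)
    exact one_le_mul_of_one_le_of_one_le
      (one_le_mul_of_one_le_of_one_le h1 (one_le_pow₀ one_le_two))
      (one_le_pow₀ (one_le_pow₀ one_le_two))
  have hs1 : (2 : ℝ) ^ (-γ) < 1 := Real.rpow_lt_one_of_one_lt_of_neg one_lt_two (by linarith)
  have hS : 0 < ∑' k : ℤ, ((2 : ℝ) ^ (-γ)) ^ k.natAbs :=
    (summable_pow_natAbs (by positivity) hs1).tsum_pos (fun k => by positivity) 0 (by simp)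
  refine ⟨K * (2 ^ γ * ∑' k : ℤ, ((2 : ℝ) ^ (-γ)) ^ k.natAbs), by positivity, fun x hx hx1 => ?_⟩
  have hwx := hpos hx hx1
  have hwx1 : wh ω x ≤ 1 := hone ▸ wh_le_wh hnn hint le_rfl hx hx1.le
  set u : ℝ := -Real.logb 2 (wh ω x) / α with hu
  have hu0 : 0 ≤ u := div_nonneg (by
    linarith [Real.logb_nonpos one_lt_two hwx.le hwx1]) hα.le
  have hwu : wh ω x = 2 ^ (-u * α) := by
    rw [hu, neg_mul, div_mul_cancel₀ _ hα.ne', neg_neg,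
      Real.rpow_logb two_pos (by norm_num) hwx]
  have hwu' : wh ω x ^ (-(γ / α)) = 2 ^ (u * γ) := by
    rw [hwu, ← Real.rpow_mul zero_le_two]
    congr 1
    field_simp
  have hterm : ∀ n : ℕ, 2 ^ ((n : ℝ) * γ) * x ^ Mfl r n ≤
      K * 2 ^ (u * γ) * 2 ^ (-γ * |n - u|) := by
    intro n
    rw [mul_assoc K, ← Real.rpow_add two_pos]
    rcases le_or_gt (n : ℝ) u with h | h
    · rw [abs_of_nonpos (by linarith), show u * γ + -γ * -((n : ℝ) - u) = n * γ by ring,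
        mul_comm K]
      gcongr
      exact (pow_le_one₀ hx hx1.le).trans hK1
    · obtain ⟨hr0', hr1⟩ := hr n
      have hlt : wh ω (r n) < wh ω x := by
        rw [hrn, hwu]
        apply Real.rpow_lt_rpow_of_exponent_lt one_lt_two
        nlinarith
      have hxr : x ≤ r n := by
        by_contra! hc
        exact hlt.not_ge (wh_le_wh hnn hint hr0' hc.le hx1.le)
      have hx' : 0 < 1 - x := by linarith
      have hr' : 0 < 1 - r n := by linarith
      have hd := wh_le_div_pow_mul_wh hnn hint hdbl' hx hxr hr1
      have hratio : ((1 - r n) / (1 - x)) ^ b ≤ 2 ^ b * (wh ω (r n) / wh ω x) := by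
        rw [← mul_div_assoc, le_div_iff₀ hwx]
        calc ((1 - r n) / (1 - x)) ^ b * wh ω x
            ≤ ((1 - r n) / (1 - x)) ^ b *
              (2 ^ b * ((1 - x) / (1 - r n)) ^ b * wh ω (r n)) := by gcongr
          _ = (((1 - r n) / (1 - x)) * ((1 - x) / (1 - r n))) ^ b * (2 ^ b * wh ω (r n)) := by
            rw [mul_pow]; ring
          _ = 2 ^ b * wh ω (r n) := by
            rw [div_mul_div_cancel₀ hx'.ne', div_self hr'.ne', one_pow, one_mul]
      have hq' : (wh ω (r n) / wh ω x) ^ q ≤ 2 ^ (-(2 * γ) * (n - u)) := by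
        rw [hrn, hwu, ← Real.rpow_sub two_pos, ← Real.rpow_natCast, ← Real.rpow_mul zero_le_two]
        apply Real.rpow_le_rpow_of_exponent_le one_le_two
        nlinarith
      have hM : x ^ Mfl r n ≤ K * 2 ^ (-(2 * γ) * (n - u)) := by
        refine (pow_floor_le hx hx1 hr0' hr1 (b * q)).trans ?_
        rw [hK, mul_assoc _ ((2 ^ b : ℝ) ^ q)]
        gcongr
        rw [pow_mul]
        refine (pow_le_pow_left₀ (by positivity) hratio q).trans ?_
        rw [mul_pow]
        gcongr
      calc (2 : ℝ) ^ ((n : ℝ) * γ) * x ^ Mfl r n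
          ≤ 2 ^ ((n : ℝ) * γ) * (K * 2 ^ (-(2 * γ) * (n - u))) := by gcongr
        _ = K * 2 ^ (u * γ + -γ * |n - u|) := by
          rw [mul_left_comm, ← Real.rpow_add two_pos, abs_of_pos (by linarith)]
          ring_nf
  calc ∑' n : ℕ, ENNReal.ofReal (2 ^ ((n : ℝ) * γ) * x ^ Mfl r n)
      ≤ ∑' n : ℕ, ENNReal.ofReal (K * 2 ^ (u * γ)) * ENNReal.ofReal (2 ^ (-γ * |n - u|)) :=
        ENNReal.tsum_le_tsum fun n => by
          rw [← ENNReal.ofReal_mul (by positivity)]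
          exact ENNReal.ofReal_le_ofReal (hterm n)
    _ = ENNReal.ofReal (K * 2 ^ (u * γ)) *
          ∑' n : ℕ, ENNReal.ofReal ((2 : ℝ) ^ (-γ * |n - u|)) := ENNReal.tsum_mul_left
    _ ≤ ENNReal.ofReal (K * 2 ^ (u * γ)) *
          ENNReal.ofReal (2 ^ γ * ∑' k : ℤ, ((2 : ℝ) ^ (-γ)) ^ k.natAbs) := by
        gcongr
        exact tsum_ofReal_rpow_abs_sub_le hγ hu0
    _ = _ := by
        rw [← ENNReal.ofReal_mul (by positivity), hwu']
        congr 1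
        ring
end
end
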